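/- arXiv:2209.04807 — 3 statements merged into one kernel-verified Lean document; each statement's English description precedes it below -/
import Mathlib

section
/- Let u ∈ K^n satisfy f(A)^ℓ u = 0 and f(A)^{ℓ−1} u ≠ 0 for some ℓ ≥ 1, and let α ∈ ℂ be a root of f. Then the vectors p^{(ℓ)}(α,u), p^{(ℓ−1)}(α,u), …, p^{(1)}(α,u) form a Jordan chain of length ℓ for A at α: p^{(1)}(α,u) ≠ 0, (A − αI)·p^{(1)}(α,u) = 0, (A − αI)·p^{(k)}(α,u) = p^{(k−1)}(α,u) for 2 ≤ k ≤ ℓ, and the ℓ vectors p^{(1)}(α,u), …, p^{(ℓ)}(α,u) are linearly independent over ℂ. -/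
open Polynomial Matrix

/-- The complex matrix obtained from a matrix over a subfield `K` of `ℂ`. -/
noncomputable def matC (K : Subfield ℂ) {n : ℕ} (A : Matrix (Fin n) (Fin n) K) :
    Matrix (Fin n) (Fin n) ℂ :=
  A.map (fun x => (x : ℂ))

/-- The complex vector obtained from a vector over a subfield `K` of `ℂ`. -/
noncomputable def vecC (K : Subfield ℂ) {n : ℕ} (w : Fin n → K) : Fin n → ℂ :=
  fun i => (w i : ℂ)

/-- For a root `α` of `f`, the quotient `g_α(x) = f(x)/(x - α)` in `ℂ[x]`,
i.e. the paper's `ψ_f(x, α)`. -/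
noncomputable def galpha (K : Subfield ℂ) (f : Polynomial K) (α : ℂ) : Polynomial ℂ :=
  (f.map K.subtype) / (X - C α)

/-- The generalized eigenvector `p⁽ᵏ⁾(α, u) = g_α(A)^k · f(A)^(ℓ-k) · u`, where
`ℓ = rank_f u`. -/
noncomputable def pvec (K : Subfield ℂ) {n : ℕ} (A : Matrix (Fin n) (Fin n) K)
    (f : Polynomial K) (α : ℂ) (ℓ k : ℕ) (u : Fin n → K) : Fin n → ℂ :=
  ((Polynomial.aeval (matC K A) (galpha K f α)) ^ k *
    (Polynomial.aeval (matC K A) (f.map K.subtype)) ^ (ℓ - k)).mulVec (vecC K u)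

/-- The nonzero members of a chain `T (v (k + 1)) = v k`, `T (v 0) = 0`, are independent. -/
theorem linearIndependent_of_chain {F V : Type*} [Field F] [AddCommGroup V] [Module F V]
    (T : Module.End F V) (v : ℕ → V) (ℓ : ℕ) (h0 : v 0 ≠ 0) (hT0 : T (v 0) = 0)
    (hT : ∀ k, k + 1 < ℓ → T (v (k + 1)) = v k) :
    LinearIndependent F (fun k : Fin ℓ => v k) := by
  induction ℓ with
  | zero => exact linearIndependent_empty_type
  | succ ℓ ih =>
    have hpow : ∀ k, k < ℓ + 1 → (T ^ k) (v k) = v 0 := by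
      intro k hk
      induction k with
      | zero => simp
      | succ k ihk => rw [pow_succ, Module.End.mul_apply, hT k hk, ihk (by omega)]
    rw [linearIndependent_finSucc']
    refine ⟨ih fun k hk => hT k (by omega), fun hmem => h0 ?_⟩
    have hle : Submodule.span F (Set.range (Fin.init fun k : Fin (ℓ + 1) => v k)) ≤
        LinearMap.ker (T ^ ℓ) := by
      rw [Submodule.span_le]
      rintro _ ⟨k, rfl⟩
      have hk := k.isLt
      obtain ⟨j, hj⟩ : ∃ j, ℓ = j + 1 + k := ⟨ℓ - 1 - k, by omega⟩
      change (T ^ ℓ) (v k) = 0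
      rw [show T ^ ℓ = T ^ (j + 1 + (k : ℕ)) by rw [← hj], pow_add, Module.End.mul_apply, hpow k (by omega), pow_succ,
        Module.End.mul_apply, hT0, map_zero]
    have := hle hmem
    rw [LinearMap.mem_ker, Fin.val_last, hpow ℓ (by omega)] at this
    exact this

theorem aeval_matC (K : Subfield ℂ) {n : ℕ} (A : Matrix (Fin n) (Fin n) K) (f : Polynomial K) :
    aeval (matC K A) (f.map K.subtype) = matC K (aeval A f) := by
  refine (map_aeval_eq_aeval_map (φ := K.subtype) (ψ := K.subtype.mapMatrix) ?_ f A).symm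
  ext r i j
  by_cases h : i = j <;> simp [algebraMap_matrix_apply, h]

theorem matC_pow (K : Subfield ℂ) {n : ℕ} (A : Matrix (Fin n) (Fin n) K) (m : ℕ) :
    matC K A ^ m = matC K (A ^ m) :=
  (map_pow K.subtype.mapMatrix A m).symm

theorem matC_mulVec_vecC (K : Subfield ℂ) {n : ℕ} (A : Matrix (Fin n) (Fin n) K)
    (w : Fin n → K) : matC K A *ᵥ vecC K w = vecC K (A *ᵥ w) :=
  funext fun i => (RingHom.map_mulVec K.subtype A w i).symm

/-- A complex polynomial annihilating a `K`-rational vector descends, coefficientwise through a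
`K`-linear form on `ℂ`, to a polynomial over `K` annihilating it. -/
theorem exists_aeval_mulVec_eq_zero (K : Subfield ℂ) {n : ℕ} (A : Matrix (Fin n) (Fin n) K)
    (w : Fin n → K) (g : Polynomial ℂ) (hg : g.Monic)
    (h : aeval (matC K A) g *ᵥ vecC K w = 0) :
    ∃ p : Polynomial K, p ≠ 0 ∧ p.natDegree ≤ g.natDegree ∧ aeval A p *ᵥ w = 0 := by
  obtain ⟨r, hr⟩ := (Algebra.linearMap K ℂ).exists_leftInverse_of_injective
    (LinearMap.ker_eq_bot.2 (algebraMap K ℂ).injective)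
  have hr1 : r 1 = 1 := by simpa using LinearMap.congr_fun hr 1
  refine ⟨∑ m ∈ Finset.range (g.natDegree + 1), monomial m (r (g.coeff m)), fun h0 => ?_, ?_, ?_⟩
  · have := congrArg (fun q => q.coeff g.natDegree) h0
    simp [coeff_monomial, hg.coeff_natDegree, hr1] at this
  · exact natDegree_sum_le_of_forall_le _ _ fun m hm =>
      (natDegree_monomial_le _).trans (by simpa [Nat.lt_succ_iff] using hm)
  · refine funext fun i => ?_
    have hi := congrArg r (congrFun h i)
    rw [aeval_eq_sum_range, sum_mulVec] at hi
    simp only [smul_mulVec, matC_pow, matC_mulVec_vecC, Finset.sum_apply, Pi.smul_apply, map_sum,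
      Pi.zero_apply, map_zero] at hi
    rw [map_sum (aeval A), sum_mulVec, Finset.sum_apply, Pi.zero_apply]
    refine Eq.trans ?_ hi
    refine Finset.sum_congr rfl fun m _ => ?_
    rw [aeval_monomial, ← Algebra.smul_def, smul_mulVec, Pi.smul_apply, smul_eq_mul, smul_eq_mul,
      mul_comm (g.coeff m)]
    change _ = r ((A ^ m *ᵥ w) i • g.coeff m)
    rw [map_smul, smul_eq_mul, mul_comm]

theorem X_sub_C_mul_galpha (K : Subfield ℂ) (f : Polynomial K) (α : ℂ)
    (hα : (f.map K.subtype).IsRoot α) : (X - C α) * galpha K f α = f.map K.subtype :=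
  mul_div_eq_iff_isRoot.2 hα

theorem galpha_mulVec_ne_zero (K : Subfield ℂ) {n : ℕ} (A : Matrix (Fin n) (Fin n) K)
    (f : Polynomial K) (hmonic : f.Monic) (hirr : Irreducible f) (α : ℂ)
    (hα : (f.map K.subtype).IsRoot α) (w : Fin n → K) (hw : w ≠ 0)
    (hfw : aeval A f *ᵥ w = 0) : aeval (matC K A) (galpha K f α) *ᵥ vecC K w ≠ 0 := by
  intro h
  have hmul := X_sub_C_mul_galpha K f α hα
  have hg : (galpha K f α).Monic :=
    (monic_X_sub_C α).of_mul_monic_left (hmul ▸ hmonic.map K.subtype)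
  have hdeg : f.natDegree = 1 + (galpha K f α).natDegree := by
    rw [← natDegree_map K.subtype, ← hmul, (monic_X_sub_C α).natDegree_mul hg, natDegree_X_sub_C]
  obtain ⟨p, hp0, hpdeg, hp⟩ := exists_aeval_mulVec_eq_zero K A w _ hg h
  have hcop : IsCoprime f p := (hirr.coprime_iff_not_dvd).2 fun hd => by
    have := natDegree_le_of_dvd hd hp0
    omega
  obtain ⟨a, b, hab⟩ := hcop
  apply hw
  have := congrArg (fun q => aeval A q *ᵥ w) hab
  simpa [add_mulVec, ← mulVec_mulVec, hfw, hp] using this.symm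

theorem stmt4 (K : Subfield ℂ) (n : ℕ) (hn : 1 ≤ n)
    (A : Matrix (Fin n) (Fin n) K) (f : Polynomial K)
    (hmonic : f.Monic) (hirr : Irreducible f) (hdvd : f ∣ A.charpoly)
    (u : Fin n → K) (ℓ : ℕ) (hℓ : 1 ≤ ℓ)
    (hker : ((Polynomial.aeval A f) ^ ℓ).mulVec u = 0)
    (hker' : ((Polynomial.aeval A f) ^ (ℓ - 1)).mulVec u ≠ 0)
    (α : ℂ) (hα : (f.map K.subtype).IsRoot α) :
    pvec K A f α ℓ 1 u ≠ 0 ∧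
      (matC K A - α • (1 : Matrix (Fin n) (Fin n) ℂ)).mulVec (pvec K A f α ℓ 1 u) = 0 ∧
      (∀ k : ℕ, 2 ≤ k → k ≤ ℓ →
        (matC K A - α • (1 : Matrix (Fin n) (Fin n) ℂ)).mulVec (pvec K A f α ℓ k u) =
          pvec K A f α ℓ (k - 1) u) ∧
      LinearIndependent ℂ (fun k : Fin ℓ => pvec K A f α ℓ (k.val + 1) u) := by
  have hcast := X_sub_C_mul_galpha K f α hα
  have hN : matC K A - α • (1 : Matrix (Fin n) (Fin n) ℂ) = aeval (matC K A) (X - C α) := by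
    simp [Algebra.algebraMap_eq_smul_one]
  have hstep : ∀ k, k + 1 ≤ ℓ →
      (matC K A - α • (1 : Matrix (Fin n) (Fin n) ℂ)) *ᵥ pvec K A f α ℓ (k + 1) u =
        pvec K A f α ℓ k u := by
    intro k hk
    obtain ⟨j, rfl⟩ := Nat.exists_eq_add_of_le hk
    rw [hN, pvec, pvec, mulVec_mulVec, show k + 1 + j - (k + 1) = j by omega,
      show k + 1 + j - k = j + 1 by omega]
    have hpoly : (X - C α) * (galpha K f α ^ (k + 1) * f.map K.subtype ^ j) =
        galpha K f α ^ k * f.map K.subtype ^ (j + 1) := by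
      rw [← hcast]
      ring
    have haeval := congrArg (aeval (matC K A)) hpoly
    rw [map_mul, map_mul, map_mul, map_pow, map_pow, map_pow, map_pow] at haeval
    rw [haeval]
  have hzero : pvec K A f α ℓ 0 u = 0 := by
    rw [pvec, pow_zero, one_mul, Nat.sub_zero, aeval_matC, matC_pow, matC_mulVec_vecC, hker]
    ext i
    simp [vecC]
  have hne : pvec K A f α ℓ 1 u ≠ 0 := by
    rw [pvec, pow_one, ← mulVec_mulVec, aeval_matC, matC_pow, matC_mulVec_vecC]
    refine galpha_mulVec_ne_zero K A f hmonic hirr α hα _ hker' ?_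
    rwa [mulVec_mulVec, ← pow_succ', Nat.sub_add_cancel hℓ]
  have hone := (hstep 0 hℓ).trans hzero
  refine ⟨hne, hone, fun k hk hkℓ => ?_, ?_⟩
  · obtain ⟨k, rfl⟩ := Nat.exists_eq_add_of_le' (show 1 ≤ k by omega)
    exact hstep k hkℓ
  · exact linearIndependent_of_chain
      (Matrix.mulVecLin (matC K A - α • (1 : Matrix (Fin n) (Fin n) ℂ)))
      (fun k => pvec K A f α ℓ (k + 1) u) ℓ hne hone fun k hk => hstep (k + 1) (by omega)
end

section
/- Let ℓ̄ be the multiplicity of f in the minimal polynomial of A, let m be the multiplicity of f in the characteristic polynomial of A, and let B be a Jordan–Krylov basis of ker f(A)^ℓ̄ with respect to A. Then m = Σ_{b∈B} rank_f b; equivalently, m = Σ_{ℓ=1}^{ℓ̄} ℓ·#{b ∈ B : rank_f b = ℓ}. -/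
open Polynomial Matrix
set_option synthInstance.maxHeartbeats 1000000
set_option maxHeartbeats 1000000

/-- The Krylov subspace `L_A(u) = Span_K {A^k u : k ≥ 0}`. -/
noncomputable def krylov (K : Subfield ℂ) {n : ℕ} (A : Matrix (Fin n) (Fin n) K)
    (u : Fin n → K) : Submodule K (Fin n → K) :=
  Submodule.span K (Set.range fun k : ℕ => (A ^ k).mulVec u)

/-- `rank_f u`: the least `ℓ` with `f(A)^ℓ u = 0`. -/
noncomputable def rankf (K : Subfield ℂ) {n : ℕ} (A : Matrix (Fin n) (Fin n) K)
    (f : Polynomial K) (u : Fin n → K) : ℕ :=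
  sInf {ℓ : ℕ | ((Polynomial.aeval A f) ^ ℓ).mulVec u = 0}

/-- `B` is a Jordan–Krylov basis of `ker f(A)^ℓ̄` with respect to `A`. -/
def IsJordanKrylovBasis (K : Subfield ℂ) {n : ℕ} (A : Matrix (Fin n) (Fin n) K)
    (f : Polynomial K) (lbar : ℕ) (B : Finset (Fin n → K)) : Prop :=
  (∀ b ∈ B, ((Polynomial.aeval A f) ^ lbar).mulVec b = 0) ∧
  iSupIndep (fun b : B => krylov K A b.val) ∧
  (⨆ b ∈ B, krylov K A b) = LinearMap.ker (((Polynomial.aeval A f) ^ lbar).mulVecLin)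

open Module

section Endomorphism

variable {F V : Type*} [Field F] [AddCommGroup V] [Module F V]

theorem Module.End.mapsTo_ker_aeval (T : End F V) (p : F[X]) :
    ∀ x ∈ LinearMap.ker (aeval T p), T x ∈ LinearMap.ker (aeval T p) := by
  intro x hx
  rw [LinearMap.mem_ker] at hx ⊢
  have h := congrArg (fun S : End F V => S x) ((Commute.all p X).map (aeval T)).eq
  simpa [hx] using h

theorem Module.End.aeval_restrict_ker_aeval (T : End F V) (p : F[X]) :
    aeval (T.restrict (T.mapsTo_ker_aeval p)) p = 0 := by
  have key : ∀ (q : F[X]) (x : LinearMap.ker (aeval T p)),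
      (aeval (T.restrict (T.mapsTo_ker_aeval p)) q x : V) = aeval T q x := by
    intro q
    induction q using Polynomial.induction_on with
    | C a => simp [Module.algebraMap_end_apply]
    | add q r hq hr => simp [hq, hr]
    | monomial k a h =>
      intro x
      rw [pow_succ, ← mul_assoc, map_mul _ _ X, map_mul _ _ X, aeval_X, aeval_X,
        Module.End.mul_apply, Module.End.mul_apply, h, LinearMap.coe_restrict_apply]
  ext x
  rw [key]
  exact x.2

/-- The cyclic subspace generated by a vector `u` whose order is `f ^ r` has dimension
`r * deg f`. -/
theorem Module.End.finrank_range_aeval_apply (T : End F V) {f : F[X]} (hf : Irreducible f) (u : V)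
    {r : ℕ} (hr : aeval T (f ^ r) u = 0) (hmin : ∀ k, aeval T (f ^ k) u = 0 → r ≤ k) :
    finrank F (LinearMap.range ((LinearMap.applyₗ u) ∘ₗ (aeval T).toLinearMap :
      F[X] →ₗ[F] V)) = r * f.natDegree := by
  set φ : F[X] →ₗ[F] V := (LinearMap.applyₗ u) ∘ₗ (aeval T).toLinearMap
  classical
  have hφa : ∀ p, φ p = aeval T p u := fun p => rfl
  have hmul : ∀ p q, φ q = 0 → φ (p * q) = 0 := by
    intro p q hq
    rw [hφa] at hq ⊢
    rw [map_mul, Module.End.mul_apply, hq, map_zero]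
  have hker : LinearMap.ker φ = (Ideal.span {f ^ r}).restrictScalars F := by
    ext p
    rw [LinearMap.mem_ker, Submodule.restrictScalars_mem, Ideal.mem_span_singleton]
    constructor
    · intro hp
      obtain ⟨k, hk, hassoc⟩ := (dvd_prime_pow hf.prime r).1 (EuclideanDomain.gcd_dvd_right p (f ^ r))
      have hgcd : φ (EuclideanDomain.gcd p (f ^ r)) = 0 := by
        rw [EuclideanDomain.gcd_eq_gcd_ab, map_add, mul_comm p, mul_comm (f ^ r), hmul _ _ hp,
          hmul _ _ hr, add_zero]
      obtain ⟨c, hc⟩ := hassoc.dvd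
      have hrk : r ≤ k := hmin k (by rw [← hφa, hc, mul_comm, hmul _ _ hgcd])
      exact ((pow_dvd_pow f hrk).trans hassoc.symm.dvd).trans (EuclideanDomain.gcd_dvd_left _ _)
    · rintro ⟨q, rfl⟩
      rw [mul_comm]
      exact hmul _ _ hr
  rw [← φ.quotKerEquivRange.finrank_eq, hker,
    (Submodule.Quotient.restrictScalarsEquiv F (Ideal.span {f ^ r})).finrank_eq,
    finrank_quotient_span_eq_natDegree, natDegree_pow]

variable [FiniteDimensional F V]

theorem LinearMap.charpoly_eq_mul_of_isCompl (T : End F V) {U W : Submodule F V}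
    (h : IsCompl U W) (hU : ∀ x ∈ U, T x ∈ U) (hW : ∀ x ∈ W, T x ∈ W) :
    T.charpoly = (T.restrict hU).charpoly * (T.restrict hW).charpoly := by
  rw [← LinearMap.charpoly_prodMap, ← (Submodule.prodEquivOfIsCompl U W h).charpoly_conj]
  congr 1
  ext x
  obtain ⟨y, rfl⟩ := (Submodule.prodEquivOfIsCompl U W h).surjective x
  simp [LinearEquiv.conj_apply]

theorem LinearMap.dvd_of_irreducible_dvd_charpoly (T : End F V) {f p : F[X]}
    (hf : Irreducible f) (hdvd : f ∣ T.charpoly) (hp : aeval T p = 0) : f ∣ p := by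
  have := Fact.mk hf
  let L := AdjoinRoot f
  have hroot : (T.baseChange L).charpoly.IsRoot (AdjoinRoot.root f) := by
    rw [LinearMap.charpoly_baseChange, IsRoot, eval_map, ← aeval_def, AdjoinRoot.aeval_eq]
    exact AdjoinRoot.mk_eq_zero.2 hdvd
  obtain ⟨v, hv⟩ := ((Module.End.hasEigenvalue_iff_isRoot_charpoly _ _).2 hroot).exists_hasEigenvector
  have h0 : aeval (T.baseChange L) (p.map (algebraMap F L)) = 0 := by
    rw [aeval_map_algebraMap]
    have := aeval_algHom_apply (Module.End.baseChangeHom F L V) T p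
    rw [hp, map_zero] at this
    exact this
  have h1 := Module.End.aeval_apply_of_hasEigenvector (p := p.map (algebraMap F L)) hv
  rw [h0, LinearMap.zero_apply, eq_comm, smul_eq_zero_iff_left hv.2, eval_map, ← aeval_def,
    AdjoinRoot.aeval_eq] at h1
  exact AdjoinRoot.mk_eq_zero.1 h1

/-- The dimension of the primary component of `T` at `f` is the multiplicity of `f` in the
characteristic polynomial times the degree of `f`. -/
theorem LinearMap.finrank_ker_aeval_pow (T : End F V) {f : F[X]} (hf : Irreducible f) {l m : ℕ}
    (hl1 : f ^ l ∣ minpoly F T) (hl2 : ¬ f ^ (l + 1) ∣ minpoly F T)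
    (hm1 : f ^ m ∣ T.charpoly) (hm2 : ¬ f ^ (m + 1) ∣ T.charpoly) :
    finrank F (LinearMap.ker (aeval T (f ^ l))) = m * f.natDegree := by
  obtain ⟨g, hg⟩ := hl1
  have hfg : ¬ f ∣ g := by
    rintro ⟨k, rfl⟩
    exact hl2 ⟨k, by rw [hg]; ring⟩
  have hcop : IsCoprime (f ^ l) g := (hf.coprime_iff_not_dvd.2 hfg).pow_left
  have hcompl : IsCompl (LinearMap.ker (aeval T (f ^ l))) (LinearMap.ker (aeval T g)) := by
    refine ⟨disjoint_ker_aeval_of_isCoprime T hcop, codisjoint_iff.2 ?_⟩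
    rw [sup_ker_aeval_eq_ker_aeval_mul_of_coprime T hcop, ← hg, minpoly.aeval, LinearMap.ker_zero]
  have hchar := LinearMap.charpoly_eq_mul_of_isCompl T hcompl (T.mapsTo_ker_aeval _)
    (T.mapsTo_ker_aeval _)
  set P := T.restrict (T.mapsTo_ker_aeval (f ^ l))
  set Q := T.restrict (T.mapsTo_ker_aeval g)
  have hfQ : ¬ f ∣ Q.charpoly := fun h =>
    hfg (Q.dvd_of_irreducible_dvd_charpoly hf h (T.aeval_restrict_ker_aeval g))
  obtain ⟨a, h, hfh, ha⟩ := WfDvdMonoid.max_power_factor P.charpoly_monic.ne_zero hf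
  have hunit : IsUnit h := by
    by_contra hnu
    have hh0 : h ≠ 0 := fun h0 => hfh (h0 ▸ dvd_zero f)
    obtain ⟨q, hq, hqh⟩ := WfDvdMonoid.exists_irreducible_factor hnu hh0
    have hqf : q ∣ f := hq.prime.dvd_of_dvd_pow <|
      P.dvd_of_irreducible_dvd_charpoly hq (ha ▸ hqh.mul_left _) (T.aeval_restrict_ker_aeval _)
    exact hfh ((hq.dvd_symm hf hqf).trans hqh)
  have hfhQ : ¬ f ∣ h * Q.charpoly := fun H => (hf.prime.dvd_or_dvd H).elim hfh hfQ
  rw [hchar, ha, mul_assoc] at hm1 hm2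
  have hma : m = a := by
    rcases lt_trichotomy m a with hlt | heq | hlt
    · exact absurd ((pow_dvd_pow f hlt).mul_right _) hm2
    · exact heq
    · have := (pow_dvd_pow f hlt).trans hm1
      rw [pow_succ, mul_dvd_mul_iff_left (pow_ne_zero _ hf.ne_zero)] at this
      exact absurd this hfhQ
  rw [← P.charpoly_natDegree, ha, natDegree_mul (pow_ne_zero _ hf.ne_zero) hunit.ne_zero,
    natDegree_pow, natDegree_eq_zero_of_isUnit hunit, hma, add_zero]

theorem iSupIndep.finrank_iSup {ι : Type*} [Fintype ι] {p : ι → Submodule F V}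
    (hp : iSupIndep p) : finrank F ↥(⨆ i, p i) = ∑ i, finrank F (p i) := by
  classical
  rw [Submodule.iSup_eq_range_dfinsupp_lsum,
    ← (LinearEquiv.ofInjective _ hp.dfinsupp_lsum_injective).finrank_eq]
  exact finrank_directSum F fun i => p i

end Endomorphism

theorem Matrix.aeval_mulVecLin {R ι : Type*} [CommRing R] [Fintype ι] [DecidableEq ι]
    (A : Matrix ι ι R) (p : R[X]) : aeval A.mulVecLin p = (aeval A p).mulVecLin :=
  aeval_algHom_apply (Matrix.toLinAlgEquiv' : Matrix ι ι R ≃ₐ[R] _).toAlgHom A p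

theorem krylov_eq_range (K : Subfield ℂ) {n : ℕ} (A : Matrix (Fin n) (Fin n) K) (u : Fin n → K) :
    krylov K A u = LinearMap.range ((LinearMap.applyₗ u) ∘ₗ (aeval A.mulVecLin).toLinearMap :
      K[X] →ₗ[K] (Fin n → K)) := by
  rw [LinearMap.range_eq_map, ← (Polynomial.basisMonomials K).span_eq, Submodule.map_span,
    ← Set.range_comp, krylov]
  congr 2
  ext1 k
  simp [Matrix.aeval_mulVecLin, ← X_pow_eq_monomial]

theorem finrank_krylov (K : Subfield ℂ) {n : ℕ} (A : Matrix (Fin n) (Fin n) K) {f : K[X]}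
    (hf : Irreducible f) {l : ℕ} {u : Fin n → K} (hu : ((aeval A f) ^ l).mulVec u = 0) :
    finrank K (krylov K A u) = rankf K A f u * f.natDegree := by
  have happ : ∀ k, aeval A.mulVecLin (f ^ k) u = ((aeval A f) ^ k).mulVec u := by
    intro k
    rw [Matrix.aeval_mulVecLin, map_pow, Matrix.mulVecLin_apply]
  rw [krylov_eq_range]
  refine Module.End.finrank_range_aeval_apply _ hf u ?_ ?_
  · rw [happ]
    exact Nat.sInf_mem (s := {l : ℕ | ((aeval A f) ^ l).mulVec u = 0}) ⟨l, hu⟩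
  · intro k hk
    rw [happ] at hk
    exact Nat.sInf_le hk

theorem stmt9 (K : Subfield ℂ) (n : ℕ) (hn : 1 ≤ n)
    (A : Matrix (Fin n) (Fin n) K) (f : Polynomial K)
    (hmonic : f.Monic) (hirr : Irreducible f) (hdvd : f ∣ A.charpoly)
    (lbar : ℕ) (hl1 : f ^ lbar ∣ minpoly K A) (hl2 : ¬ f ^ (lbar + 1) ∣ minpoly K A)
    (m : ℕ) (hm1 : f ^ m ∣ A.charpoly) (hm2 : ¬ f ^ (m + 1) ∣ A.charpoly)
    (B : Finset (Fin n → K)) (hB : IsJordanKrylovBasis K A f lbar B) :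
    m = ∑ b ∈ B, rankf K A f b := by
  obtain ⟨hker, hind, hsup⟩ := hB
  have hmin : minpoly K A.mulVecLin = minpoly K A :=
    minpoly.algEquiv_eq (Matrix.toLinAlgEquiv' : Matrix (Fin n) (Fin n) K ≃ₐ[K] _) A
  have hdim := LinearMap.finrank_ker_aeval_pow A.mulVecLin hirr (hmin ▸ hl1) (hmin ▸ hl2)
    (A.charpoly_mulVecLin.symm ▸ hm1) (A.charpoly_mulVecLin.symm ▸ hm2)
  rw [Matrix.aeval_mulVecLin, map_pow, ← hsup, iSup_subtype', hind.finrank_iSup,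
    Finset.sum_coe_sort B fun b => finrank K (krylov K A b),
    Finset.sum_congr rfl fun b hb => finrank_krylov K A hirr (hker b hb),
    ← Finset.sum_mul] at hdim
  exact (Nat.eq_of_mul_eq_mul_right hirr.natDegree_pos hdim).symm
end

section
/- Let ℓ̄ be the multiplicity of f in the minimal polynomial of A. Suppose b_1, …, b_r ∈ ker f(A)^ℓ̄ are Jordan–Krylov independent with respect to A, and v ∈ ker f(A)^ℓ̄ is a non-zero vector such that f(A)^{rank_f v − 1} v does not lie in Σ_{i=1}^{r} L_A(f(A)^{rank_f b_i − 1} b_i). Then the r+1 Krylov subspaces L_A(b_1), …, L_A(b_r), L_A(v) form an independent family (satisfy the direct sum condition). -/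
open Polynomial Matrix
set_option synthInstance.maxHeartbeats 1000000
set_option maxHeartbeats 1000000

/-- Adjoining to an independent family an element disjoint from its supremum keeps it independent. -/
theorem iSupIndep.option_elim {α ι : Type*} [CompleteLattice α] [IsModularLattice α]
    {t : ι → α} (ht : iSupIndep t) {a : α} (ha : Disjoint a (⨆ i, t i)) :
    iSupIndep (fun o : Option ι => o.elim a t) := by
  rintro (_ | i)
  · refine ha.mono_right (iSup₂_le ?_)
    rintro (_ | j) hj
    · exact absurd rfl hj
    · exact le_iSup t j
  · have hsup : t i ⊔ (⨆ (j) (_ : j ≠ i), t j) ≤ ⨆ j, t j :=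
      sup_le (le_iSup t i) (iSup₂_le fun j _ => le_iSup t j)
    refine ((ht i).disjoint_sup_right_of_disjoint_sup_left
      (ha.symm.mono_left hsup)).mono_right (iSup₂_le ?_)
    rintro (_ | j) hj
    · exact le_sup_right
    · exact le_sup_of_le_left (le_iSup₂_of_le j (fun h => hj (congrArg some h)) le_rfl)

section Krylov

variable {K : Subfield ℂ} {n : ℕ} {A : Matrix (Fin n) (Fin n) K}

theorem mem_krylov_iff {u x : Fin n → K} :
    x ∈ krylov K A u ↔ ∃ p : K[X], (aeval A p).mulVec u = x := by
  constructor
  · intro hx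
    induction hx using Submodule.span_induction with
    | mem x hx =>
      obtain ⟨k, rfl⟩ := hx
      exact ⟨X ^ k, by simp⟩
    | zero => exact ⟨0, by simp⟩
    | add x y _ _ hx hy =>
      obtain ⟨p, rfl⟩ := hx
      obtain ⟨q, rfl⟩ := hy
      exact ⟨p + q, by rw [map_add, add_mulVec]⟩
    | smul c x _ hx =>
      obtain ⟨p, rfl⟩ := hx
      exact ⟨c • p, by rw [map_smul, smul_mulVec]⟩
  · rintro ⟨p, rfl⟩
    induction p using Polynomial.induction_on' with
    | add p q hp hq =>
      rw [map_add, add_mulVec]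
      exact add_mem hp hq
    | monomial k c =>
      rw [← C_mul_X_pow_eq_monomial, ← smul_eq_C_mul, map_smul, smul_mulVec, map_pow, aeval_X]
      exact Submodule.smul_mem _ _ (Submodule.subset_span ⟨k, rfl⟩)

theorem aeval_mulVec_mem_krylov {u x : Fin n → K} (hx : x ∈ krylov K A u) (p : K[X]) :
    (aeval A p).mulVec x ∈ krylov K A u := by
  obtain ⟨q, rfl⟩ := mem_krylov_iff.1 hx
  exact mem_krylov_iff.2 ⟨p * q, by rw [map_mul, mulVec_mulVec]⟩

theorem aeval_mulVec_mem_iSup_krylov {ι : Type*} {b : ι → Fin n → K} {x : Fin n → K}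
    (hx : x ∈ ⨆ i, krylov K A (b i)) (p : K[X]) :
    (aeval A p).mulVec x ∈ ⨆ i, krylov K A (b i) := by
  induction hx using Submodule.iSup_induction' with
  | mem i x hx => exact Submodule.mem_iSup_of_mem i (aeval_mulVec_mem_krylov hx p)
  | zero => simp
  | add x y _ _ hx hy =>
    rw [mulVec_add]
    exact add_mem hx hy

/-- If an invariant subspace contains `f(A) ^ m u` and `q(A) u`, and `f ^ (k + 1)` does not
divide `q`, then it contains `f(A) ^ k u`. -/
theorem aeval_pow_mulVec_mem_of_not_dvd {f q : K[X]} (hf : Irreducible f)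
    {W : Submodule K (Fin n → K)}
    (hW : ∀ x ∈ W, ∀ p : K[X], (aeval A p).mulVec x ∈ W) {u : Fin n → K} {m k : ℕ}
    (hm : ((aeval A f) ^ m).mulVec u ∈ W) (hq : (aeval A q).mulVec u ∈ W)
    (hk : ¬ f ^ (k + 1) ∣ q) : ((aeval A f) ^ k).mulVec u ∈ W := by
  classical
  obtain ⟨j, -, hj⟩ := (dvd_prime_pow hf.prime m).1 (EuclideanDomain.gcd_dvd_left (f ^ m) q)
  have hjk : j ≤ k := by
    by_contra! h
    exact hk ((pow_dvd_pow f h).trans (hj.dvd'.trans (EuclideanDomain.gcd_dvd_right _ _)))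
  obtain ⟨c, hc⟩ := hj.dvd.trans (pow_dvd_pow f hjk)
  rw [← map_pow, hc, mul_comm, map_mul, ← mulVec_mulVec]
  refine hW _ ?_ c
  rw [EuclideanDomain.gcd_eq_gcd_ab, mul_comm (f ^ m), mul_comm q, map_add, add_mulVec, map_mul,
    map_mul, ← mulVec_mulVec, ← mulVec_mulVec, map_pow]
  exact add_mem (hW _ hm _) (hW _ hq _)

theorem rankf_spec {f : K[X]} {u : Fin n → K} {m : ℕ}
    (hm : ((aeval A f) ^ m).mulVec u = 0) :
    ((aeval A f) ^ rankf K A f u).mulVec u = 0 :=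
  Nat.sInf_mem (s := {l : ℕ | ((aeval A f) ^ l).mulVec u = 0}) ⟨m, hm⟩

theorem rankf_pos {f : K[X]} {u : Fin n → K} {m : ℕ}
    (hm : ((aeval A f) ^ m).mulVec u = 0) (hu : u ≠ 0) : 0 < rankf K A f u := by
  refine Nat.pos_of_ne_zero fun h => hu ?_
  simpa [h] using rankf_spec hm

theorem pow_pred_rankf_mulVec_ne_zero {f : K[X]} {u : Fin n → K} {m : ℕ}
    (hm : ((aeval A f) ^ m).mulVec u = 0) (hu : u ≠ 0) :
    ((aeval A f) ^ (rankf K A f u - 1)).mulVec u ≠ 0 := fun h =>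
  Nat.notMem_of_lt_sInf (s := {l : ℕ | ((aeval A f) ^ l).mulVec u = 0})
    (Nat.sub_lt (rankf_pos hm hu) one_pos) h

/-- The elements of a Krylov subspace killed by `f(A)` lie in the Krylov subspace of the last
nonzero vector of the chain. -/
theorem mem_krylov_pow_pred_rankf {f : K[X]} (hf : Irreducible f) {u x : Fin n → K} {m : ℕ}
    (hm : ((aeval A f) ^ m).mulVec u = 0) (hx : x ∈ krylov K A u)
    (hfx : (aeval A f).mulVec x = 0) :
    x ∈ krylov K A (((aeval A f) ^ (rankf K A f u - 1)).mulVec u) := by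
  obtain ⟨q, rfl⟩ := mem_krylov_iff.1 hx
  rcases eq_or_ne u 0 with rfl | hu
  · simp
  have hpos := rankf_pos hm hu
  have hdvd : f ^ (rankf K A f u - 1 + 1) ∣ f * q := by
    by_contra h
    refine pow_pred_rankf_mulVec_ne_zero hm hu ?_
    rw [← Submodule.mem_bot K]
    refine aeval_pow_mulVec_mem_of_not_dvd hf (m := m) ?_ ((Submodule.mem_bot K).2 hm) ?_ h
    · intro y hy p
      rw [(Submodule.mem_bot K).1 hy, mulVec_zero]
      exact zero_mem _
    · rw [map_mul, ← mulVec_mulVec, hfx]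
      exact zero_mem _
  rw [pow_succ', mul_dvd_mul_iff_left hf.ne_zero] at hdvd
  obtain ⟨c, rfl⟩ := hdvd
  exact mem_krylov_iff.2 ⟨c, by rw [mulVec_mulVec, mul_comm, map_mul, map_pow]⟩

/-- For an independent family of Krylov subspaces, the elements of the sum killed by `f(A)` lie
in the sum of the Krylov subspaces of the last nonzero vectors of the chains. -/
theorem mem_iSup_krylov_pow_pred_rankf {ι : Type*} [Fintype ι] {f : K[X]} (hf : Irreducible f)
    {b : ι → Fin n → K} {m : ℕ} (hm : ∀ i, ((aeval A f) ^ m).mulVec (b i) = 0)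
    (hb : iSupIndep fun i => krylov K A (b i)) {x : Fin n → K}
    (hx : x ∈ ⨆ i, krylov K A (b i)) (hfx : (aeval A f).mulVec x = 0) :
    x ∈ ⨆ i, krylov K A (((aeval A f) ^ (rankf K A f (b i) - 1)).mulVec (b i)) := by
  obtain ⟨w, hw, rfl⟩ := (Submodule.mem_iSup_iff_exists_finsupp _ _).1 hx
  have hkill := (iSupIndep_iff_finsetSum_eq_zero_imp_eq_zero _).1 hb w.support
    (fun i => (aeval A f).mulVec (w i)) (fun i _ => aeval_mulVec_mem_krylov (hw i) f)
    (by rw [← hfx, Finsupp.sum, mulVec_sum])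
  exact Submodule.sum_mem _ fun i hi => Submodule.mem_iSup_of_mem i
    (mem_krylov_pow_pred_rankf hf (hm i) (hw i) (hkill i hi))

end Krylov

theorem stmt12 (K : Subfield ℂ) (n : ℕ) (hn : 1 ≤ n)
    (A : Matrix (Fin n) (Fin n) K) (f : Polynomial K)
    (hmonic : f.Monic) (hirr : Irreducible f) (hdvd : f ∣ A.charpoly)
    (lbar : ℕ) (hl1 : f ^ lbar ∣ minpoly K A) (hl2 : ¬ f ^ (lbar + 1) ∣ minpoly K A)
    (r : ℕ) (b : Fin r → (Fin n → K))
    (hbker : ∀ i, ((Polynomial.aeval A f) ^ lbar).mulVec (b i) = 0)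
    (hbindep : iSupIndep (fun i : Fin r => krylov K A (b i)))
    (v : Fin n → K) (hv0 : v ≠ 0)
    (hvker : ((Polynomial.aeval A f) ^ lbar).mulVec v = 0)
    (hv : ((Polynomial.aeval A f) ^ (rankf K A f v - 1)).mulVec v ∉
      ⨆ i : Fin r,
        krylov K A (((Polynomial.aeval A f) ^ (rankf K A f (b i) - 1)).mulVec (b i))) :
    iSupIndep (fun o : Option (Fin r) =>
      o.elim (krylov K A v) (fun i => krylov K A (b i))) := by
  refine hbindep.option_elim (Submodule.disjoint_def.2 fun x hxv hxb => ?_)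
  obtain ⟨p, rfl⟩ := mem_krylov_iff.1 hxv
  by_contra hne
  have hpos := rankf_pos hvker hv0
  have hrank := rankf_spec hvker
  refine hv (mem_iSup_krylov_pow_pred_rankf hirr hbker hbindep ?_ ?_)
  · refine aeval_pow_mulVec_mem_of_not_dvd hirr (m := lbar) (q := p)
      (fun y hy q => aeval_mulVec_mem_iSup_krylov hy q) (by rw [hvker]; exact zero_mem _) hxb ?_
    rw [Nat.sub_add_cancel hpos]
    rintro ⟨c, rfl⟩
    rw [mul_comm, map_mul, ← mulVec_mulVec, map_pow, hrank, mulVec_zero] at hne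
    exact hne rfl
  · rw [mulVec_mulVec, ← pow_succ', Nat.sub_add_cancel hpos, hrank]
end
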